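/- arXiv:2202.06903 — 5 statements merged into one kernel-verified Lean document; each statement's English description precedes it below -/
import Mathlib

section
/- Let A be an n×n symmetric integer matrix with n ≥ 6. Write A in block form with B = [[a_{1,3}, a_{1,4}],[a_{2,3}, a_{2,4}]], B₁ the 2×(n−3) matrix with rows (a_{1,3}, a_{1,5}, …, a_{1,n}) and (a_{2,3}, a_{2,5}, …, a_{2,n}), and B₂ the 2×(n−3) matrix with rows (a_{1,4}, a_{1,5}, …, a_{1,n}) and (a_{2,4}, a_{2,5}, …, a_{2,n}). Suppose rank_off(A) = 2, rank(B) = 2, and rank(B₁) = rank(B₂) = 1. Then A has block form A = [[A₁, B, 0],[Bᵀ, A₂, C],[0, Cᵀ, D]] where A₁, A₂ are symmetric 2×2 integer matrices, B is an invertible 2×2 integer matrix, C is a 2×(n−4) integer matrix, and D = diag(d₁,…,d_{n−4}) is diagonal. -/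
open Matrix

/-- A square submatrix larger than the rank of a matrix over a field has determinant zero. -/
theorem Matrix.det_submatrix_eq_zero_of_rank_lt {K m n ι : Type*} [Field K] [Fintype n]
    [Fintype ι] [DecidableEq ι] (M : Matrix m n K) (f : ι → m) (g : ι → n)
    (h : M.rank < Fintype.card ι) : (M.submatrix f g).det = 0 := by
  by_contra hdet
  exact h.not_ge (rank_of_det_ne_zero hdet ▸ rank_submatrix_le M f g)

/-- A square matrix of full rank over a field has nonzero determinant. -/
theorem Matrix.det_ne_zero_of_rank_eq_card {K n : Type*} [Field K] [Fintype n] [DecidableEq n]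
    {M : Matrix n n K} (h : M.rank = Fintype.card n) : M.det ≠ 0 := by
  rw [← isUnit_iff_ne_zero, ← isUnit_iff_isUnit_det, ← linearIndependent_rows_iff_isUnit,
    linearIndependent_iff_card_eq_finrank_span, ← h, rank_eq_finrank_span_row]
  rfl

/-- Lemma 4.7: let A be symmetric n×n (n ≥ 6) with off-diagonal rank 2,
rank(B) = 2 and rank(B₁) = rank(B₂) = 1 (B, B₁, B₂ as in the paper,
here with 0-based indices).  Then A has the block form
[[A₁, B, 0],[Bᵀ, A₂, C],[0, Cᵀ, D]] with D diagonal; equivalently,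
a_{i,j} = 0 whenever i ≤ 2 and j ≥ 5 (in 1-based indexing), and
a_{i,j} = 0 whenever i ≠ j and i, j ≥ 5. -/
theorem stmt_6 (m : ℕ) (A : Matrix (Fin (m + 6)) (Fin (m + 6)) ℤ)
    (hsym : A.IsSymm)
    (hoff : ∀ (k l : ℕ) (f : Fin k → Fin (m + 6)) (g : Fin l → Fin (m + 6)),
      (∀ i j, f i ≠ g j) → ((A.submatrix f g).map ((↑) : ℤ → ℚ)).rank ≤ 2)
    (hB : ((A.map ((↑) : ℤ → ℚ)).submatrix
        (fun i : Fin 2 => (Fin.castLE (by omega) i : Fin (m + 6)))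
        (fun j : Fin 2 => (⟨j.val + 2, by omega⟩ : Fin (m + 6)))).rank = 2)
    (hB1 : ((A.map ((↑) : ℤ → ℚ)).submatrix
        (fun i : Fin 2 => (Fin.castLE (by omega) i : Fin (m + 6)))
        (fun j : Fin (m + 3) => if j.val = 0 then (⟨2, by omega⟩ : Fin (m + 6))
          else ⟨j.val + 3, by omega⟩)).rank = 1)
    (hB2 : ((A.map ((↑) : ℤ → ℚ)).submatrix
        (fun i : Fin 2 => (Fin.castLE (by omega) i : Fin (m + 6)))
        (fun j : Fin (m + 3) => (⟨j.val + 3, by omega⟩ : Fin (m + 6)))).rank = 1) :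
    (∀ i j : Fin (m + 6), i.val ≤ 1 → 4 ≤ j.val → A i j = 0) ∧
    (∀ i j : Fin (m + 6), 4 ≤ i.val → 4 ≤ j.val → i ≠ j → A i j = 0) := by
  have hdetB : A ⟨0, by omega⟩ ⟨2, by omega⟩ * A ⟨1, by omega⟩ ⟨3, by omega⟩
      - A ⟨0, by omega⟩ ⟨3, by omega⟩ * A ⟨1, by omega⟩ ⟨2, by omega⟩ ≠ 0 := by
    intro h
    have hdet := det_ne_zero_of_rank_eq_card (hB.trans (by simp))
    rw [det_fin_two] at hdet
    exact hdet (by simpa [Fin.castLE] using congrArg ((↑) : ℤ → ℚ) h)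
  have hcol : ∀ j : Fin (m + 6), 4 ≤ j.val →
      A ⟨0, by omega⟩ j = 0 ∧ A ⟨1, by omega⟩ j = 0 := by
    intro j hj
    have h1 := det_submatrix_eq_zero_of_rank_lt _ id
      ![⟨0, by omega⟩, ⟨j.val - 3, by omega⟩] (hB1.trans_lt (by simp))
    have h2 := det_submatrix_eq_zero_of_rank_lt _ id
      ![⟨0, by omega⟩, ⟨j.val - 3, by omega⟩] (hB2.trans_lt (by simp))
    have hj3 : j.val - 3 + 3 = j.val := by omega
    have hj0 : j.val - 3 ≠ 0 := by omega
    simp only [det_fin_two, submatrix_apply, map_apply, id, cons_val_zero, cons_val_one, hj3, hj0,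
      if_true, if_false, Fin.castLE] at h1 h2
    norm_cast at h1 h2
    change A ⟨0, by omega⟩ ⟨2, by omega⟩ * A ⟨1, by omega⟩ j
      - A ⟨0, by omega⟩ j * A ⟨1, by omega⟩ ⟨2, by omega⟩ = 0 at h1
    change A ⟨0, by omega⟩ ⟨3, by omega⟩ * A ⟨1, by omega⟩ j
      - A ⟨0, by omega⟩ j * A ⟨1, by omega⟩ ⟨3, by omega⟩ = 0 at h2
    constructor <;> refine (mul_eq_zero.1 ?_).resolve_left hdetB
    · linear_combination A ⟨0, by omega⟩ ⟨3, by omega⟩ * h1 - A ⟨0, by omega⟩ ⟨2, by omega⟩ * h2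
    · linear_combination A ⟨1, by omega⟩ ⟨3, by omega⟩ * h1 - A ⟨1, by omega⟩ ⟨2, by omega⟩ * h2
  refine ⟨fun i j hi hj => ?_, fun i j hi hj hij => ?_⟩
  · obtain h | h : i = ⟨0, by omega⟩ ∨ i = ⟨1, by omega⟩ := by
      simp only [Fin.ext_iff]; omega
    · exact h ▸ (hcol j hj).1
    · exact h ▸ (hcol j hj).2
  · have h := det_submatrix_eq_zero_of_rank_lt _ id id ((hoff 3 3
      ![⟨0, by omega⟩, ⟨1, by omega⟩, i] ![⟨2, by omega⟩, ⟨3, by omega⟩, j] (by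
        rw [Ne, Fin.ext_iff] at hij
        simp only [Fin.forall_fin_succ, Fin.ext_iff, ne_eq, cons_val_zero, cons_val_succ]
        simp
        omega)).trans_lt (by simp))
    simp only [det_fin_three, submatrix_apply, map_apply, id, cons_val_zero, cons_val_one,
      cons_val, (hcol j hj).1, (hcol j hj).2] at h
    norm_cast at h
    refine (mul_eq_zero.1 ?_).resolve_left hdetB
    linear_combination h
end

section
/- Let A be an n×n symmetric integer matrix with rank_off(A) = 2 such that B = [[a_{1,3},a_{1,4}],[a_{2,3},a_{2,4}]] has rank 2 and both B₁ and B₂ (as defined below) have rank 2. Then A has block form A = [[A₁, (γ₁,γ₂)C],[Cᵀ(γ₁,γ₂)ᵀ, D + CᵀHC]] where A₁ is symmetric 2×2 with integer entries, (γ₁,γ₂) is an invertible 2×2 rational matrix, C is a 2×(n−2) integer matrix, H is a 2×2 rational matrix, and D = diag(d₁,…,d_{n−2}) is a rational diagonal matrix. -/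
open Matrix

/-- If `P` has full row rank and consists of rows of a matrix `Q` of no larger rank,
then every row of `Q` is a combination of the rows of `P`. -/
theorem exists_row_combination {κ ι : Type*} [Fintype κ] [Fintype ι] {k : ℕ}
    (P : Matrix κ ι ℚ) (Q : Matrix (Fin k) ι ℚ) (r : Fin k) (e : κ → Fin k)
    (hP : P.rank = Fintype.card κ) (hQ : Q.rank ≤ Fintype.card κ)
    (hPQ : ∀ i, Q (e i) = P i) :
    ∃ u : κ → ℚ, ∀ j, Q r j = ∑ i, u i * P i j := by
  rw [Matrix.rank_eq_finrank_span_row] at hP hQ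
  have hle : Submodule.span ℚ (Set.range P.row) ≤ Submodule.span ℚ (Set.range Q.row) := by
    apply Submodule.span_mono
    rintro _ ⟨i, rfl⟩
    exact ⟨e i, hPQ i⟩
  have heq := Submodule.eq_of_le_of_finrank_le hle (hQ.trans hP.ge)
  have hr : Q.row r ∈ Submodule.span ℚ (Set.range P.row) :=
    heq ▸ Submodule.subset_span ⟨r, rfl⟩
  obtain ⟨u, hu⟩ := (Submodule.mem_span_range_iff_exists_fun ℚ).1 hr
  refine ⟨u, fun j => ?_⟩
  have := congrFun hu j
  simpa [Matrix.row, Finset.sum_apply] using this.symm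

/-- If each row of a symmetric matrix `S` agrees off the diagonal with a combination of the rows
of a full row rank matrix `C`, then `S` agrees off the diagonal with some `Cᵀ * H * C`. -/
theorem exists_offDiag_eq_congr {κ ι : Type*} [Fintype κ] [Fintype ι]
    [DecidableEq κ] (C : Matrix κ ι ℚ) (S : Matrix ι ι ℚ)
    (hC : C.rank = Fintype.card κ) (hS : S.IsSymm) (U : ι → κ → ℚ)
    (hU : ∀ i j, i ≠ j → S i j = ∑ k, U i k * C k j) :
    ∃ H : Matrix κ κ ℚ, ∀ i j, i ≠ j → S i j = (Cᵀ * H * C) i j := by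
  have hsurj : Function.Surjective C.mulVec := by
    have h : LinearMap.range C.mulVecLin = ⊤ := by
      apply Submodule.eq_top_of_finrank_eq
      rw [Module.finrank_fintype_fun_eq_card]
      exact hC
    exact LinearMap.range_eq_top.1 h
  obtain ⟨R, hR⟩ := Matrix.mulVec_surjective_iff_exists_right_inverse.1 hsurj
  have hT : Matrix.of U * C = Cᵀ * (Matrix.of U)ᵀ := by
    ext i j
    rcases eq_or_ne i j with rfl | hij
    · simp [Matrix.mul_apply, mul_comm]
    · have h1 := hU i j hij
      rw [← hS.apply i j, hU j i hij.symm] at h1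
      simpa [Matrix.mul_apply, mul_comm] using h1.symm
  refine ⟨(Matrix.of U)ᵀ * R, fun i j hij => ?_⟩
  have h : Cᵀ * ((Matrix.of U)ᵀ * R) * C = Matrix.of U * C := by
    rw [← Matrix.mul_assoc Cᵀ, ← hT, Matrix.mul_assoc (Matrix.of U), hR, Matrix.mul_one]
  rw [h, hU i j hij, Matrix.mul_apply]
  rfl

/-- A matrix with a full row rank column selection has full row rank. -/
theorem rank_eq_card_of_submatrix {κ ι ι' : Type*} [Fintype κ] [Fintype ι] [Fintype ι']
    (M : Matrix κ ι ℚ) (g : ι' → ι) (h : (M.submatrix id g).rank = Fintype.card κ) :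
    M.rank = Fintype.card κ := by
  exact le_antisymm M.rank_le_card_height (h.ge.trans (M.rank_submatrix_le id g))

/-- Lemma 4.11 (structure lemma for the case rank(B₁)=rank(B₂)=2):
A symmetric integer n×n matrix with off-diagonal rank 2, rank(B)=2 and
rank(B₁)=rank(B₂)=2 has block form
[[A₁, (γ₁,γ₂)C],[Cᵀ(γ₁,γ₂)ᵀ, D + CᵀHC]] with (γ₁,γ₂) invertible over ℚ. -/
theorem stmt_9 (m : ℕ) (A : Matrix (Fin (m + 5)) (Fin (m + 5)) ℤ)
    (hsym : A.IsSymm)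
    (hoff : ∀ (k l : ℕ) (f : Fin k → Fin (m + 5)) (g : Fin l → Fin (m + 5)),
      (∀ i j, f i ≠ g j) → ((A.submatrix f g).map ((↑) : ℤ → ℚ)).rank ≤ 2)
    (hB : ((A.map ((↑) : ℤ → ℚ)).submatrix
        (fun i : Fin 2 => (Fin.castLE (by omega) i : Fin (m + 5)))
        (fun j : Fin 2 => (⟨j.val + 2, by omega⟩ : Fin (m + 5)))).rank = 2)
    (hB1 : ((A.map ((↑) : ℤ → ℚ)).submatrix
        (fun i : Fin 2 => (Fin.castLE (by omega) i : Fin (m + 5)))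
        (fun j : Fin (m + 2) => if j.val = 0 then (⟨2, by omega⟩ : Fin (m + 5))
          else ⟨j.val + 3, by omega⟩)).rank = 2)
    (hB2 : ((A.map ((↑) : ℤ → ℚ)).submatrix
        (fun i : Fin 2 => (Fin.castLE (by omega) i : Fin (m + 5)))
        (fun j : Fin (m + 2) => (⟨j.val + 3, by omega⟩ : Fin (m + 5)))).rank = 2) :
    ∃ (G : Matrix (Fin 2) (Fin 2) ℚ) (C : Matrix (Fin 2) (Fin (m + 3)) ℤ)
      (H : Matrix (Fin 2) (Fin 2) ℚ) (d : Fin (m + 3) → ℚ),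
      G.det ≠ 0 ∧
      (∀ (i : Fin 2) (j : Fin (m + 3)),
        (A (Fin.castLE (by omega) i) ⟨j.val + 2, by omega⟩ : ℚ)
          = (G * C.map ((↑) : ℤ → ℚ)) i j) ∧
      (∀ i j : Fin (m + 3), (A ⟨i.val + 2, by omega⟩ ⟨j.val + 2, by omega⟩ : ℚ)
          = (if i = j then d i else 0)
            + ((C.map ((↑) : ℤ → ℚ))ᵀ * H * C.map ((↑) : ℤ → ℚ)) i j) := by

  set C : Matrix (Fin 2) (Fin (m + 3)) ℤ :=
    A.submatrix (fun i => Fin.castLE (by omega) i) (fun j => ⟨j.val + 2, by omega⟩) with hCdef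
  set S : Matrix (Fin (m + 3)) (Fin (m + 3)) ℚ :=
    (A.map ((↑) : ℤ → ℚ)).submatrix (fun i => ⟨i.val + 2, by omega⟩)
      (fun j => ⟨j.val + 2, by omega⟩) with hSdef
  have hC : (C.map ((↑) : ℤ → ℚ)).rank = Fintype.card (Fin 2) :=
    rank_eq_card_of_submatrix _ (Fin.castLE (by omega) : Fin 2 → Fin (m + 3)) hB
  have hS : S.IsSymm := (hsym.map _).submatrix _
  have hdel (i : Fin (m + 3)) :
      ((C.map ((↑) : ℤ → ℚ)).submatrix id i.succAbove).rank = Fintype.card (Fin 2) := by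
    rcases Nat.lt_or_ge i.val 2 with hi | hi
    · rcases (by omega : i.val = 0 ∨ i.val = 1) with hi | hi
      · refine (congrArg Matrix.rank ?_).trans hB2
        ext a j
        simp only [hCdef, submatrix_apply, map_apply, id]
        congr 3
        simp [Fin.succAbove, Fin.lt_def, hi]
      · refine (congrArg Matrix.rank ?_).trans hB1
        ext a j
        simp only [hCdef, submatrix_apply, map_apply, id]
        congr 2
        by_cases hj : j.val = 0 <;> simp [Fin.succAbove, Fin.lt_def, hi, hj]
    · have hm : 2 ≤ m + 2 := by omega
      refine rank_eq_card_of_submatrix _ (Fin.castLE hm) ?_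
      refine (congrArg Matrix.rank ?_).trans hB
      ext a j
      simp only [hCdef, submatrix_apply, map_apply, id]
      congr 3
      have : j.val < i.val := by omega
      simp [Fin.succAbove, Fin.lt_def, this]
  have hrow (i : Fin (m + 3)) : ∃ u : Fin 2 → ℚ, ∀ j, i ≠ j →
      S i j = ∑ k, u k * C.map ((↑) : ℤ → ℚ) k j := by
    let f : Fin 3 → Fin (m + 5) := Fin.snoc (α := fun _ => Fin (m + 5))
      (fun k : Fin 2 => (Fin.castLE (by omega) k : Fin (m + 5))) ⟨i.val + 2, by omega⟩
    let g : Fin (m + 2) → Fin (m + 5) := fun j => ⟨(i.succAbove j).val + 2, by omega⟩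
    have hf_last : f (Fin.last 2) = ⟨i.val + 2, by omega⟩ := Fin.snoc_last ..
    have hf_cast (k : Fin 2) : f k.castSucc = Fin.castLE (by omega) k := Fin.snoc_castSucc ..
    have hfg : ∀ a j, f a ≠ g j := by
      intro a j
      induction a using Fin.lastCases with
      | last =>
        rw [hf_last]
        intro h
        exact Fin.succAbove_ne i j (Fin.ext (by simpa [g] using h.symm))
      | cast a =>
        rw [hf_cast]
        simp only [g, ne_eq, Fin.ext_iff, Fin.val_castLE]
        omega
    obtain ⟨u, hu⟩ := exists_row_combination _ _ (Fin.last 2) Fin.castSucc (hdel i)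
      (hoff _ _ f g hfg) (fun a => by ext j; simp [hf_cast, hCdef, g])
    refine ⟨u, fun j hij => ?_⟩
    obtain ⟨l, rfl⟩ := Fin.exists_succAbove_eq hij.symm
    have h := hu l
    simp only [map_apply, submatrix_apply, hf_last, id] at h
    exact h
  choose U hU using hrow
  obtain ⟨H, hH⟩ := exists_offDiag_eq_congr _ S hC hS U hU
  refine ⟨1, C, H, fun i => S i i - ((C.map ((↑) : ℤ → ℚ))ᵀ * H * C.map ((↑) : ℤ → ℚ)) i i,
    by simp, fun i j => by rw [Matrix.one_mul]; rfl, fun i j => ?_⟩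
  rcases eq_or_ne i j with rfl | hij
  · simp [hSdef]
  · rw [if_neg hij, zero_add, ← hH i j hij]
    rfl
end

section
/- For real X ≥ 2 and nonzero rationals a, h and c, let M be the 2×2 rational matrix [[a, 1],[c, hc]] and assume rank(M) = 2. Then the number of (x,z,x',z') ∈ ℤ⁴ with all coordinates bounded by X in absolute value and (x,z) M (x',z')ᵀ = 0, i.e. a·x·x' + x·z' + c·z·x' + h·c·z·z' = 0, is O(X² log X). -/
open Matrix

/-- The quadruples `(-k b, k a, g a, g b)` with `1 ≤ g ≤ N`, `0 < |a| ≤ N / g`, `|b| ≤ |a|` and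
`|k| ≤ N / |a|`. -/
noncomputable def dominantOrthogonalPairs (N : ℕ) : Finset (ℤ × ℤ × ℤ × ℤ) :=
  (Finset.range N).biUnion fun i =>
    ((Finset.Icc (-((N / (i + 1) : ℕ) : ℤ)) ((N / (i + 1) : ℕ) : ℤ)).erase 0).biUnion fun a =>
      (Finset.Icc (-|a|) |a| ×ˢ Finset.Icc (-((N : ℤ) / |a|)) ((N : ℤ) / |a|)).image fun q =>
        (-(q.2 * q.1), q.2 * a, ((i : ℤ) + 1) * a, ((i : ℤ) + 1) * q.1)

theorem card_dominantOrthogonalPairs_le (N : ℕ) :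
    ((dominantOrthogonalPairs N).card : ℝ) ≤ 18 * (N : ℝ) ^ 2 * (1 + Real.log N) := by
  have fibre_le (i : ℕ) (hi : i ∈ Finset.range N) (a : ℤ)
      (ha : a ∈ (Finset.Icc (-((N / (i + 1) : ℕ) : ℤ)) ((N / (i + 1) : ℕ) : ℤ)).erase 0) :
      ((Finset.Icc (-|a|) |a| ×ˢ Finset.Icc (-((N : ℤ) / |a|)) ((N : ℤ) / |a|)).image fun q =>
        (-(q.2 * q.1), q.2 * a, ((i : ℤ) + 1) * a, ((i : ℤ) + 1) * q.1)).card ≤ 9 * N := by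
    refine Finset.card_image_le.trans ?_
    rw [Finset.card_product, Int.card_Icc, Int.card_Icc]
    rw [Finset.mem_erase, Finset.mem_Icc, ← abs_le] at ha
    obtain ⟨ha0, ha1⟩ := ha
    have hpos : 0 < |a| := abs_pos.mpr ha0
    have haN : |a| ≤ N := ha1.trans (by exact_mod_cast Nat.div_le_self N (i + 1))
    have hq : 1 ≤ (N : ℤ) / |a| := by
      rw [Int.le_ediv_iff_mul_le hpos]; linarith
    have hmul : (N : ℤ) / |a| * |a| ≤ N := Int.ediv_mul_le _ hpos.ne'
    generalize (N : ℤ) / |a| = q at *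
    generalize |a| = m at *
    zify
    rw [Int.toNat_of_nonneg (by linarith), Int.toNat_of_nonneg (by linarith)]
    nlinarith
  have hnat : (dominantOrthogonalPairs N).card ≤
      ∑ i ∈ Finset.range N, 2 * (N / (i + 1)) * (9 * N) := by
    refine Finset.card_biUnion_le.trans (Finset.sum_le_sum fun i hi => ?_)
    refine (Finset.card_biUnion_le_card_mul _ _ _ (fibre_le i hi)).trans ?_
    refine Nat.mul_le_mul_right _ ?_
    rw [Finset.card_erase_of_mem (by simp; positivity), Int.card_Icc]
    omega
  have hharm : (∑ i ∈ Finset.range N, ((i : ℝ) + 1)⁻¹) ≤ 1 + Real.log N := by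
    have := harmonic_le_one_add_log N
    simpa [harmonic] using this
  calc ((dominantOrthogonalPairs N).card : ℝ)
      ≤ ((∑ i ∈ Finset.range N, 2 * (N / (i + 1)) * (9 * N) : ℕ) : ℝ) := by exact_mod_cast hnat
    _ ≤ ∑ i ∈ Finset.range N, 18 * (N : ℝ) ^ 2 * ((i : ℝ) + 1)⁻¹ := by
        rw [Nat.cast_sum]
        refine Finset.sum_le_sum fun i _ => ?_
        have h1 : ((N / (i + 1) : ℕ) : ℝ) ≤ N * ((i : ℝ) + 1)⁻¹ := by
          have := @Nat.cast_div_le ℝ _ _ _ N (i + 1)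
          rwa [Nat.cast_add_one, div_eq_mul_inv] at this
        rw [Nat.cast_mul, Nat.cast_mul, Nat.cast_mul]
        have hN : (0 : ℝ) ≤ N := N.cast_nonneg
        nlinarith [mul_le_mul_of_nonneg_left h1 hN]
    _ ≤ 18 * (N : ℝ) ^ 2 * (1 + Real.log N) := by
        rw [← Finset.mul_sum]; gcongr

theorem mem_dominantOrthogonalPairs {N : ℕ} {u v s t : ℤ} (hv : |v| ≤ N) (hs : |s| ≤ N)
    (hs0 : s ≠ 0) (hts : |t| ≤ |s|) (h : u * s + v * t = 0) :
    (u, v, s, t) ∈ dominantOrthogonalPairs N := by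
  obtain ⟨g, a, b, hg, hab, rfl, rfl⟩ :
      ∃ (g : ℕ) (a b : ℤ), 0 < g ∧ IsCoprime a b ∧ s = g * a ∧ t = g * b := by
    have hg : 0 < Int.gcd s t := Int.gcd_pos_of_ne_zero_left _ hs0
    obtain ⟨a, b, hab, h1, h2⟩ := Int.exists_gcd_one hg
    exact ⟨_, a, b, hg, Int.isCoprime_iff_gcd_eq_one.mpr hab, by rw [mul_comm]; exact h1,
      by rw [mul_comm]; exact h2⟩
  have hgZ : (0 : ℤ) < g := by exact_mod_cast hg
  have ha0 : a ≠ 0 := right_ne_zero_of_mul hs0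
  have hapos : 0 < |a| := abs_pos.mpr ha0
  have h' : u * a + v * b = 0 := by
    refine (mul_eq_zero.mp (?_ : (g : ℤ) * (u * a + v * b) = 0)).resolve_left hgZ.ne'
    linarith
  obtain ⟨k, rfl⟩ : a ∣ v := hab.dvd_of_dvd_mul_right ⟨-u, by linarith⟩
  have hu : u = -(k * b) := mul_right_cancel₀ ha0 (by linarith)
  rw [abs_mul, abs_of_pos hgZ] at hs
  rw [abs_mul, abs_mul, abs_of_pos hgZ] at hts
  rw [abs_mul] at hv
  obtain ⟨i, rfl⟩ : ∃ i, g = i + 1 := ⟨g - 1, by omega⟩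
  push_cast at *
  simp only [dominantOrthogonalPairs, Finset.mem_biUnion, Finset.mem_image, Finset.mem_product,
    Finset.mem_erase, Finset.mem_Icc, Finset.mem_range, ← abs_le]
  refine ⟨i, ?_, a, ⟨ha0, ?_⟩, (b, k), ⟨?_, ?_⟩, ?_⟩
  · zify; nlinarith
  · push_cast
    rw [Int.le_ediv_iff_mul_le hgZ]; linarith
  · exact le_of_mul_le_mul_left hts hgZ
  · rw [Int.le_ediv_iff_mul_le hapos]; linarith
  · simp [hu, mul_comm]

/-- A finite set containing all `(u, v, s, t) ∈ [-N, N]⁴` with `u s + v t = 0`. -/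
noncomputable def orthogonalPairsCover (N : ℕ) : Finset (ℤ × ℤ × ℤ × ℤ) :=
  dominantOrthogonalPairs N ∪
    (dominantOrthogonalPairs N).image (fun p => (p.2.1, p.1, p.2.2.2, p.2.2.1)) ∪
    Finset.Icc (-(N : ℤ)) N ×ˢ Finset.Icc (-(N : ℤ)) N ×ˢ {0} ×ˢ {0}

theorem card_orthogonalPairsCover_le {N : ℕ} (hN : 1 ≤ N) :
    ((orthogonalPairsCover N).card : ℝ) ≤ 45 * (N : ℝ) ^ 2 * (1 + Real.log N) := by
  have hzero : (Finset.Icc (-(N : ℤ)) N ×ˢ Finset.Icc (-(N : ℤ)) N ×ˢ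
      ({0} : Finset ℤ) ×ˢ ({0} : Finset ℤ)).card ≤ 9 * N ^ 2 := by
    simp only [Finset.card_product, Int.card_Icc, Finset.card_singleton, mul_one]
    rw [show ((N : ℤ) + 1 - -N).toNat = 2 * N + 1 by omega]
    nlinarith
  have hnat : (orthogonalPairsCover N).card ≤
      (dominantOrthogonalPairs N).card + (dominantOrthogonalPairs N).card + 9 * N ^ 2 :=
    (Finset.card_union_le _ _).trans <| add_le_add
      ((Finset.card_union_le _ _).trans (Nat.add_le_add_left Finset.card_image_le _)) hzero
  have hreal : ((orthogonalPairsCover N).card : ℝ) ≤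
      (dominantOrthogonalPairs N).card + (dominantOrthogonalPairs N).card + 9 * (N : ℝ) ^ 2 := by
    exact_mod_cast hnat
  have hlog : 0 ≤ (N : ℝ) ^ 2 * Real.log N :=
    mul_nonneg (sq_nonneg _) (Real.log_natCast_nonneg N)
  linarith [card_dominantOrthogonalPairs_le N]

theorem mem_orthogonalPairsCover {N : ℕ} {u v s t : ℤ} (hu : |u| ≤ N) (hv : |v| ≤ N)
    (hs : |s| ≤ N) (ht : |t| ≤ N) (h : u * s + v * t = 0) :
    (u, v, s, t) ∈ orthogonalPairsCover N := by
  simp only [orthogonalPairsCover, Finset.mem_union]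
  by_cases hst : s = 0 ∧ t = 0
  · right
    simpa [hst.1, hst.2, ← abs_le] using And.intro hu hv
  left
  rcases le_total |t| |s| with hle | hle
  · left
    refine mem_dominantOrthogonalPairs hv hs (fun hs0 => hst ⟨hs0, ?_⟩) hle h
    simpa [hs0] using hle
  · right
    refine Finset.mem_image.mpr ⟨(v, u, t, s), ?_, rfl⟩
    refine mem_dominantOrthogonalPairs hu ht (fun ht0 => hst ⟨?_, ht0⟩) hle (by linarith)
    simpa [ht0] using hle

/-- The number of zeros of a nondegenerate integral bilinear form in two plus two variables in the
box `[-X, X]⁴` is `O(X² log X)`. -/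
theorem exists_ncard_bilinear_zeros_le (A B C D : ℤ) (hdet : A * D - B * C ≠ 0) :
    ∃ K : ℝ, 0 < K ∧ ∀ X : ℝ, 2 ≤ X →
      (({p : ℤ × ℤ × ℤ × ℤ |
          |(p.1 : ℝ)| ≤ X ∧ |(p.2.1 : ℝ)| ≤ X ∧ |(p.2.2.1 : ℝ)| ≤ X ∧ |(p.2.2.2 : ℝ)| ≤ X ∧
          (A * p.1 + C * p.2.1) * p.2.2.1 + (B * p.1 + D * p.2.1) * p.2.2.2 = 0}).ncard : ℝ)
      ≤ K * X ^ 2 * Real.log X := by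
  set L : ℝ := 1 + |(A : ℝ)| + |(B : ℝ)| + |(C : ℝ)| + |(D : ℝ)| with hL
  have hA := abs_nonneg (A : ℝ)
  have hB := abs_nonneg (B : ℝ)
  have hC := abs_nonneg (C : ℝ)
  have hD := abs_nonneg (D : ℝ)
  have hL1 : 1 ≤ L := by linarith
  have hlogL : 0 ≤ Real.log L := Real.log_nonneg hL1
  refine ⟨45 * L ^ 2 * (3 + 2 * Real.log L), by positivity, fun X hX => ?_⟩
  set N : ℕ := ⌊L * X⌋₊ with hNdef
  have hLX : X ≤ L * X := by nlinarith
  have hN : 1 ≤ N := Nat.one_le_floor_iff _ |>.mpr (by linarith)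
  have hNle : (N : ℝ) ≤ L * X := Nat.floor_le (by linarith)
  have le_N {m : ℤ} (hm : |(m : ℝ)| ≤ L * X) : |m| ≤ N := by
    rw [Int.abs_eq_natAbs]
    refine Int.ofNat_le.mpr (Nat.le_floor ?_)
    rwa [Nat.cast_natAbs, Int.cast_abs]
  have form_le {P Q x z : ℤ} (hPQ : |(P : ℝ)| + |(Q : ℝ)| ≤ L) (hx : |(x : ℝ)| ≤ X)
      (hz : |(z : ℝ)| ≤ X) : |P * x + Q * z| ≤ N := by
    refine le_N ?_
    push_cast
    calc |(P : ℝ) * x + Q * z| ≤ |(P : ℝ)| * |(x : ℝ)| + |(Q : ℝ)| * |(z : ℝ)| := by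
          rw [← abs_mul, ← abs_mul]; exact abs_add_le _ _
      _ ≤ |(P : ℝ)| * X + |(Q : ℝ)| * X := by gcongr
      _ ≤ L * X := by rw [← add_mul]; gcongr
  have hcard := Set.ncard_le_ncard_of_injOn (s := {p : ℤ × ℤ × ℤ × ℤ |
          |(p.1 : ℝ)| ≤ X ∧ |(p.2.1 : ℝ)| ≤ X ∧ |(p.2.2.1 : ℝ)| ≤ X ∧ |(p.2.2.2 : ℝ)| ≤ X ∧
          (A * p.1 + C * p.2.1) * p.2.2.1 + (B * p.1 + D * p.2.1) * p.2.2.2 = 0})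
    (t := (orthogonalPairsCover N : Set (ℤ × ℤ × ℤ × ℤ)))
    (fun p => (A * p.1 + C * p.2.1, B * p.1 + D * p.2.1, p.2.2.1, p.2.2.2))
    (by
      rintro ⟨x, z, x', z'⟩ ⟨hx, hz, hx', hz', h⟩
      exact mem_orthogonalPairsCover (form_le (by linarith) hx hz) (form_le (by linarith) hx hz)
        (le_N (hx'.trans hLX)) (le_N (hz'.trans hLX)) h)
    (by
      rintro ⟨x, z, x', z'⟩ - ⟨y, w, y', w'⟩ - h
      simp only [Prod.mk.injEq] at h ⊢
      obtain ⟨h1, h2, h3, h4⟩ := h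
      refine ⟨mul_left_cancel₀ hdet ?_, mul_left_cancel₀ hdet ?_, h3, h4⟩
      · linear_combination D * h1 - C * h2
      · linear_combination A * h2 - B * h1)
    (Finset.finite_toSet _)
  rw [Set.ncard_coe_finset] at hcard
  have hN0 : (0 : ℝ) < N := by exact_mod_cast hN
  have hlogX : 1 ≤ 2 * Real.log X := by
    have := Real.log_le_log two_pos hX
    linarith [Real.log_two_gt_d9]
  have hlogN : Real.log N ≤ Real.log L + Real.log X := by
    rw [← Real.log_mul (by positivity) (by positivity)]
    exact Real.log_le_log hN0 hNle
  have hlogN0 := Real.log_natCast_nonneg N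
  calc _ ≤ ((orthogonalPairsCover N).card : ℝ) := by exact_mod_cast hcard
    _ ≤ 45 * (N : ℝ) ^ 2 * (1 + Real.log N) := card_orthogonalPairsCover_le hN
    _ ≤ 45 * (L * X) ^ 2 * ((3 + 2 * Real.log L) * Real.log X) := by
        gcongr
        nlinarith
    _ = _ := by ring

/-- The k = n = 2 case of the bilinear counting lemma: for the rank-2 rational
matrix M = [[a, 1],[c, hc]] (a, c, h nonzero rationals), the number of integer
solutions of (x,z) M (x',z')ᵀ = 0, i.e. a x x' + x z' + c z x' + h c z z' = 0,
in the box [−X,X]⁴ is O(X² log X). -/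
theorem stmt_12 (a h c : ℚ) (ha : a ≠ 0) (hh : h ≠ 0) (hc : c ≠ 0)
    (hrank : (!![a, 1; c, h * c] : Matrix (Fin 2) (Fin 2) ℚ).rank = 2) :
    ∃ K : ℝ, 0 < K ∧ ∀ X : ℝ, 2 ≤ X →
      (({p : ℤ × ℤ × ℤ × ℤ |
          |(p.1 : ℝ)| ≤ X ∧ |(p.2.1 : ℝ)| ≤ X ∧ |(p.2.2.1 : ℝ)| ≤ X ∧ |(p.2.2.2 : ℝ)| ≤ X ∧
          a * p.1 * p.2.2.1 + p.1 * p.2.2.2 + c * p.2.1 * p.2.2.1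
            + h * c * p.2.1 * p.2.2.2 = 0}).ncard : ℝ)
      ≤ K * X ^ 2 * Real.log X := by
  have hdet : a * (h * c) - c ≠ 0 := by
    intro h0
    have hli := (Matrix.linearIndependent_rows_iff_isUnit
      (A := (!![a, 1; c, h * c] : Matrix (Fin 2) (Fin 2) ℚ))).mp
      (by rw [linearIndependent_iff_card_eq_finrank_span, Set.finrank,
        ← Matrix.rank_eq_finrank_span_row, hrank, Fintype.card_fin])
    rw [Matrix.isUnit_iff_isUnit_det, Matrix.det_fin_two_of, one_mul, h0] at hli
    exact not_isUnit_zero hli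
  obtain ⟨⟨d, hd⟩, hmultiple⟩ := IsLocalization.exist_integer_multiples_of_finset
    (nonZeroDivisors ℤ) ({a, c, h * c} : Finset ℚ)
  have hd0 : d ≠ 0 := nonZeroDivisors.ne_zero hd
  obtain ⟨A, hA⟩ := hmultiple a (by simp)
  obtain ⟨C, hC⟩ := hmultiple c (by simp)
  obtain ⟨H, hH⟩ := hmultiple (h * c) (by simp)
  simp only [algebraMap_int_eq, eq_intCast, zsmul_eq_mul] at hA hC hH
  have hdQ : (d : ℚ) ≠ 0 := by exact_mod_cast hd0
  obtain ⟨K, hK, hbound⟩ := exists_ncard_bilinear_zeros_le A d C H (by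
    intro h0
    have h1 : (A : ℚ) * H - d * C = 0 := by exact_mod_cast h0
    rw [hA, hC, hH] at h1
    refine mul_ne_zero (pow_ne_zero 2 hdQ) hdet ?_
    linear_combination h1)
  refine ⟨K, hK, fun X hX => ?_⟩
  convert hbound X hX using 6 with p
  simp only [and_congr_right_iff]
  intros
  rw [← mul_right_inj' hdQ, mul_zero, ← @Int.cast_inj ℚ]
  push_cast
  rw [hA, hC, hH]
  refine Eq.congr ?_ rfl
  ring
end

section
/- Let B ∈ GL₂(ℚ), let ξ₁, ξ₂ ∈ ℚ², d₁, d₂ ∈ ℚ with d₁·d₂ ≠ 0, and let A₁ be a symmetric 2×2 rational matrix. Then the number of integer tuples (x', z₁, z₂, z₁', z₂', s') ∈ ℤ² × ℤ⁴ (with x' ∈ ℤ²), all coordinates bounded by X in absolute value, satisfying −(z₁ξ₁ᵀ + z₂ξ₂ᵀ)B^{−1}A₁x' + d₁z₁z₁' + d₂z₂z₂' = 0, is O(X⁴ log X). -/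
open Matrix

/-- A solution of `a * b = c * d` with `a ≠ 0` factors as `a = g * h`, `b = k * l`, `c = g * k`,
`d = h * l`, with `g` positive. -/
lemma exists_factorization_of_mul_eq_mul {a b c d : ℤ} (ha : a ≠ 0)
    (h : a * b = c * d) :
    ∃ g h k l : ℤ, 0 < g ∧ a = g * h ∧ b = k * l ∧ c = g * k ∧ d = h * l := by
  obtain ⟨g, e, ⟨k, rfl⟩, ⟨l, rfl⟩, rfl⟩ := exists_dvd_and_dvd_of_dvd_mul (Dvd.intro b h)
  have hb : b = k * l := by
    apply mul_left_cancel₀ ha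
    rw [h]; ring
  rcases lt_or_gt_of_ne (left_ne_zero_of_mul ha) with hg | hg
  · exact ⟨-g, -e, -k, -l, by omega, by ring, by rw [hb]; ring, by ring, by ring⟩
  · exact ⟨g, e, k, l, hg, rfl, hb, rfl, rfl⟩

/-- The integer solutions of `a * b = c * d` in the box `[-N, N]⁴`. -/
noncomputable def mulEqMulBox (N : ℕ) : Finset (ℤ × ℤ × ℤ × ℤ) :=
  (Finset.Icc (-(N : ℤ)) N ×ˢ Finset.Icc (-(N : ℤ)) N ×ˢ Finset.Icc (-(N : ℤ)) N ×ˢ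
    Finset.Icc (-(N : ℤ)) N).filter fun p => p.1 * p.2.1 = p.2.2.1 * p.2.2.2

/-- Tuples `(g, l, h, k)` with `1 ≤ g ≤ N`, `|l| ≤ g` and `|h|, |k| ≤ N / g`. -/
noncomputable def divisorTuples (N : ℕ) : Finset (Σ _ : ℕ, ℤ × ℤ × ℤ) :=
  (Finset.Icc 1 N).sigma fun g =>
    Finset.Icc (-(g : ℤ)) g ×ˢ Finset.Icc (-((N / g : ℕ) : ℤ)) (N / g : ℕ) ×ˢ
      Finset.Icc (-((N / g : ℕ) : ℤ)) (N / g : ℕ)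

lemma card_Icc_neg_self (n : ℕ) : (Finset.Icc (-(n : ℤ)) n).card = 2 * n + 1 := by
  rw [Int.card_Icc]; omega

lemma card_divisorTuples_le (N : ℕ) :
    ((divisorTuples N).card : ℝ) ≤ 27 * (N : ℝ) ^ 2 * (1 + Real.log N) := by
  have hsum : ((divisorTuples N).card : ℝ) ≤
      ∑ g ∈ Finset.Icc 1 N, 27 * (N : ℝ) ^ 2 * (g : ℝ)⁻¹ := by
    rw [divisorTuples, Finset.card_sigma, Nat.cast_sum]
    refine Finset.sum_le_sum fun g hg => ?_
    obtain ⟨hg1, hgN⟩ := Finset.mem_Icc.1 hg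
    simp only [Finset.card_product, card_Icc_neg_self]
    push_cast
    have hg0 : (1 : ℝ) ≤ g := by exact_mod_cast hg1
    have hq : ((N / g : ℕ) : ℝ) ≤ N / g := Nat.cast_div_le
    have hq1 : (1 : ℝ) ≤ N / g := by
      rw [le_div_iff₀ (by linarith), one_mul]; exact_mod_cast hgN
    calc (2 * (g : ℝ) + 1) * ((2 * ((N / g : ℕ) : ℝ) + 1) * (2 * ((N / g : ℕ) : ℝ) + 1))
        ≤ (3 * g) * ((3 * (N / g)) * (3 * (N / g))) := by
          gcongr <;> linarith
      _ = 27 * (N : ℝ) ^ 2 * (g : ℝ)⁻¹ := by field_simp; ring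
  refine hsum.trans ?_
  rw [← Finset.mul_sum]
  have h := harmonic_le_one_add_log N
  rw [harmonic_eq_sum_Icc] at h
  push_cast at h
  gcongr

lemma mem_Icc_div_of_mul_mem {N : ℕ} {g : ℕ} {h : ℤ} (hg : 0 < g)
    (hm : (g : ℤ) * h ∈ Finset.Icc (-(N : ℤ)) N) :
    h ∈ Finset.Icc (-((N / g : ℕ) : ℤ)) (N / g : ℕ) := by
  rw [Finset.mem_Icc, ← abs_le] at *
  rw [abs_mul, Nat.abs_cast] at hm
  push_cast
  rw [Int.le_ediv_iff_mul_le (by exact_mod_cast hg), mul_comm]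
  exact hm

lemma mem_divisorTuples {N g : ℕ} {l h k : ℤ} (hg : 0 < g) (hl : |l| ≤ g) (hh : h ≠ 0)
    (h1 : (g : ℤ) * h ∈ Finset.Icc (-(N : ℤ)) N) (h2 : (g : ℤ) * k ∈ Finset.Icc (-(N : ℤ)) N) :
    (⟨g, l, h, k⟩ : Σ _ : ℕ, ℤ × ℤ × ℤ) ∈ divisorTuples N := by
  have hgN : g ≤ N := by
    rw [Finset.mem_Icc, ← abs_le, abs_mul, Nat.abs_cast] at h1
    have := Int.one_le_abs hh
    exact_mod_cast (le_mul_of_one_le_right (by positivity) this).trans h1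
  simp only [divisorTuples, Finset.mem_sigma, Finset.mem_product]
  exact ⟨Finset.mem_Icc.2 ⟨hg, hgN⟩, Finset.mem_Icc.2 (abs_le.1 hl),
    mem_Icc_div_of_mul_mem hg h1, mem_Icc_div_of_mul_mem hg h2⟩

/-- The box solutions come from pairs of free variables when a coordinate vanishes, and from
`divisorTuples` otherwise. -/
lemma mulEqMulBox_subset (N : ℕ) :
    mulEqMulBox N ⊆
      (Finset.univ ×ˢ (Finset.Icc (-(N : ℤ)) N ×ˢ Finset.Icc (-(N : ℤ)) N)).image
        (fun q : (Bool × Bool) × ℤ × ℤ =>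
          (bif q.1.1 then q.2.1 else 0, bif q.1.1 then 0 else q.2.1,
            bif q.1.2 then q.2.2 else 0, bif q.1.2 then 0 else q.2.2)) ∪
      ((divisorTuples N).image
        (fun q => ((q.1 : ℤ) * q.2.2.1, q.2.2.2 * q.2.1, (q.1 : ℤ) * q.2.2.2, q.2.2.1 * q.2.1)) ∪
      (divisorTuples N).image
        (fun q => (q.2.1 * q.2.2.1, q.2.2.2 * q.1, q.2.1 * q.2.2.2, q.2.2.1 * (q.1 : ℤ)))) := by
  rintro ⟨a, b, c, d⟩ hp
  simp only [mulEqMulBox, Finset.mem_filter, Finset.mem_product] at hp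
  obtain ⟨⟨ha, hb, hc, hd⟩, h⟩ := hp
  by_cases h0 : a * b = 0
  · refine Finset.mem_union_left _ (Finset.mem_image.2 ?_)
    rcases mul_eq_zero.1 h0 with rfl | rfl <;> rcases mul_eq_zero.1 (h ▸ h0) with rfl | rfl
    · exact ⟨((false, false), b, d), by simp_all, rfl⟩
    · exact ⟨((false, true), b, c), by simp_all, rfl⟩
    · exact ⟨((true, false), a, d), by simp_all, rfl⟩
    · exact ⟨((true, true), a, c), by simp_all, rfl⟩
  · have h0' : c * d ≠ 0 := h ▸ h0
    refine Finset.mem_union_right _ ?_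
    obtain ⟨g, e, k, l, hg, rfl, rfl, rfl, rfl⟩ := exists_factorization_of_mul_eq_mul
      (left_ne_zero_of_mul h0) h
    have he : e ≠ 0 := left_ne_zero_of_mul (right_ne_zero_of_mul h0')
    have hl : l ≠ 0 := right_ne_zero_of_mul (right_ne_zero_of_mul h0')
    rcases le_total |l| g with hlg | hlg
    · refine Finset.mem_union_left _ (Finset.mem_image.2 ?_)
      lift g to ℕ using hg.le
      exact ⟨⟨g, l, e, k⟩, mem_divisorTuples (by exact_mod_cast hg) hlg he ha hc, rfl⟩
    · refine Finset.mem_union_right _ (Finset.mem_image.2 ?_)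
      rw [mul_comm] at hb hd
      have hga : |g| ≤ |l| := by rwa [abs_of_pos hg]
      obtain ⟨n, rfl | rfl⟩ := Int.eq_nat_or_neg l
      · have hn : 0 < n := by omega
        exact ⟨⟨n, g, e, k⟩, mem_divisorTuples hn (by simpa using hga) he hd hb, rfl⟩
      · have hn : 0 < n := by omega
        refine ⟨⟨n, -g, -e, -k⟩, mem_divisorTuples hn (by simpa using hga) (neg_ne_zero.2 he)
          ?_ ?_, by simp⟩
        · simpa only [mul_neg, neg_mul] using hd
        · simpa only [mul_neg, neg_mul] using hb

lemma card_mulEqMulBox_le {N : ℕ} (hN : 1 ≤ N) :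
    ((mulEqMulBox N).card : ℝ) ≤ 90 * (N : ℝ) ^ 2 * (1 + Real.log N) := by
  have hcard := (Finset.card_le_card (mulEqMulBox_subset N)).trans <|
    (Finset.card_union_le _ _).trans <| Nat.add_le_add Finset.card_image_le <|
      (Finset.card_union_le _ _).trans <| Nat.add_le_add Finset.card_image_le Finset.card_image_le
  simp only [Finset.card_product, card_Icc_neg_self, Finset.card_univ, Fintype.card_prod,
    Fintype.card_bool] at hcard
  have hcard' : ((mulEqMulBox N).card : ℝ) ≤ 2 * 2 * ((2 * N + 1) * (2 * N + 1)) +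
      ((divisorTuples N).card + (divisorTuples N).card) := by exact_mod_cast hcard
  have hT := card_divisorTuples_le N
  have hN' : (1 : ℝ) ≤ N := by exact_mod_cast hN
  have hlog : 0 ≤ (N : ℝ) ^ 2 * Real.log N := mul_nonneg (by positivity) (Real.log_nonneg hN')
  nlinarith

lemma abs_le_floor_of_abs_le {m : ℤ} {X : ℝ} (h : |(m : ℝ)| ≤ X) : |m| ≤ (⌊X⌋₊ : ℤ) := by
  rw [← Int.natCast_natAbs]
  exact_mod_cast Nat.le_floor (by rwa [Nat.cast_natAbs, Int.cast_abs])

/-- Box solutions of `z (d u - a ⬝ x) + w (e v - b ⬝ x) = 0` inject into pairs of a vector `x`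
and a solution of `r * s = t * q`. -/
lemma ncard_bilinear_le (a₀ a₁ b₀ b₁ d e : ℤ) (hd : d ≠ 0) (he : e ≠ 0) (C n : ℕ)
    (hC : |a₀| + |a₁| + |b₀| + |b₁| + |d| + |e| ≤ C) (S : Set ((Fin 2 → ℤ) × ℤ × ℤ × ℤ × ℤ))
    (hS : ∀ p ∈ S, (∀ i, |p.1 i| ≤ n) ∧ |p.2.1| ≤ n ∧ |p.2.2.1| ≤ n ∧ |p.2.2.2.1| ≤ n ∧
      |p.2.2.2.2| ≤ n ∧ p.2.1 * (d * p.2.2.2.1 - (a₀ * p.1 0 + a₁ * p.1 1)) =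
        p.2.2.1 * (b₀ * p.1 0 + b₁ * p.1 1 - e * p.2.2.2.2)) :
    S.ncard ≤ (2 * n + 1) ^ 2 * (mulEqMulBox (C * n)).card := by
  have hbox : ((Fintype.piFinset fun _ : Fin 2 => Finset.Icc (-(n : ℤ)) n) ×ˢ
      mulEqMulBox (C * n)).card = (2 * n + 1) ^ 2 * (mulEqMulBox (C * n)).card := by
    rw [Finset.card_product, Fintype.card_piFinset]
    simp [card_Icc_neg_self, -Int.card_Icc]
  rw [← hbox, ← Set.ncard_coe_finset]
  have hC1 : (1 : ℤ) ≤ C := by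
    have := Int.one_le_abs hd
    linarith [abs_nonneg a₀, abs_nonneg a₁, abs_nonneg b₀, abs_nonneg b₁, abs_nonneg e]
  refine Set.ncard_le_ncard_of_injOn (fun p => (p.1, p.2.1,
    d * p.2.2.2.1 - (a₀ * p.1 0 + a₁ * p.1 1), p.2.2.1,
    b₀ * p.1 0 + b₁ * p.1 1 - e * p.2.2.2.2)) ?_ ?_ (Finset.finite_toSet _)
  · rintro ⟨x, z, w, z', w'⟩ hp
    obtain ⟨hx, hz, hw, hz', hw', heq⟩ := hS _ hp
    dsimp only at hx hz hw hz' hw' heq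
    have key : ∀ r s t y : ℤ, |y| ≤ n → |r| + |s| + |t| ≤ C →
        |r * y - (s * x 0 + t * x 1)| ≤ C * n := by
      intro r s t y hy hrst
      calc |r * y - (s * x 0 + t * x 1)| ≤ |r * y| + |s * x 0 + t * x 1| := abs_sub _ _
        _ ≤ |r * y| + (|s * x 0| + |t * x 1|) := by gcongr; exact abs_add_le _ _
        _ = |r| * |y| + (|s| * |x 0| + |t| * |x 1|) := by simp only [abs_mul]
        _ ≤ |r| * n + (|s| * n + |t| * n) := by gcongr <;> exact hx _
        _ = (|r| + |s| + |t|) * n := by ring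
        _ ≤ C * n := by gcongr
    have hle : ∀ y : ℤ, |y| ≤ n → |y| ≤ C * n := fun y hy =>
      hy.trans (le_mul_of_one_le_left (by positivity) hC1)
    have h1 := key d a₀ a₁ z' hz' (by linarith [abs_nonneg b₀, abs_nonneg b₁, abs_nonneg e])
    have h2 := key e b₀ b₁ w' hw' (by linarith [abs_nonneg a₀, abs_nonneg a₁, abs_nonneg d])
    rw [abs_sub_comm] at h2
    simp only [Finset.coe_product, Set.mem_prod, Finset.mem_coe, Fintype.mem_piFinset,
      mulEqMulBox, Finset.mem_filter, Finset.mem_product, Finset.mem_Icc, ← abs_le, Nat.cast_mul]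
    exact ⟨hx, ⟨hle _ hz, h1, hle _ hw, h2⟩, heq⟩
  · rintro ⟨x, z, w, z', w'⟩ - ⟨y, u, v, u', v'⟩ - h
    simp only [Prod.mk.injEq] at h
    obtain ⟨rfl, rfl, h1, rfl, h2⟩ := h
    have h1' : z' = u' := mul_left_cancel₀ hd (by linarith)
    have h2' : w' = v' := mul_left_cancel₀ he (by linarith)
    rw [h1', h2']

/-- Counting estimate from the proof of Lemma 4.4: for B ∈ GL₂(ℚ), ξ₁, ξ₂ ∈ ℚ²,
d₁d₂ ≠ 0 and A₁ symmetric 2×2 rational, the number of integer tuples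
(x', z₁, z₂, z₁', z₂') with all coordinates bounded by X satisfying
−(z₁ξ₁ᵀ + z₂ξ₂ᵀ)B⁻¹A₁x' + d₁z₁z₁' + d₂z₂z₂' = 0 is O(X⁴ log X). -/
theorem stmt_16 (B : Matrix (Fin 2) (Fin 2) ℚ) (hB : B.det ≠ 0)
    (ξ₁ ξ₂ : Fin 2 → ℚ) (d₁ d₂ : ℚ) (hd : d₁ * d₂ ≠ 0)
    (A₁ : Matrix (Fin 2) (Fin 2) ℚ) (hA₁ : A₁.IsSymm) :
    ∃ K : ℝ, 0 < K ∧ ∀ X : ℝ, 2 ≤ X →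
      (({p : (Fin 2 → ℤ) × ℤ × ℤ × ℤ × ℤ |
          (∀ i, |(p.1 i : ℝ)| ≤ X) ∧ |(p.2.1 : ℝ)| ≤ X ∧ |(p.2.2.1 : ℝ)| ≤ X ∧
          |(p.2.2.2.1 : ℝ)| ≤ X ∧ |(p.2.2.2.2 : ℝ)| ≤ X ∧
          -(dotProduct
              (vecMul (fun i => (p.2.1 : ℚ) * ξ₁ i + (p.2.2.1 : ℚ) * ξ₂ i) (B⁻¹ * A₁))
              (fun i => (p.1 i : ℚ)))
            + d₁ * p.2.1 * p.2.2.2.1 + d₂ * p.2.2.1 * p.2.2.2.2 = 0}).ncard : ℝ)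
      ≤ K * X ^ 4 * Real.log X := by
  obtain ⟨a, ha⟩ : ∃ a, a = vecMul ξ₁ (B⁻¹ * A₁) := ⟨_, rfl⟩
  obtain ⟨b, hb⟩ : ∃ b, b = vecMul ξ₂ (B⁻¹ * A₁) := ⟨_, rfl⟩
  obtain ⟨⟨D, hD⟩, hint⟩ := IsLocalization.exist_integer_multiples_of_finite
    (nonZeroDivisors ℤ) ![a 0, a 1, b 0, b 1, d₁, d₂]
  have hD0 : (D : ℚ) ≠ 0 := by exact_mod_cast nonZeroDivisors.ne_zero hD
  choose m hm using hint
  have ha0 : (m 0 : ℚ) = D * a 0 := by simpa using hm 0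
  have ha1 : (m 1 : ℚ) = D * a 1 := by simpa using hm 1
  have hb0 : (m 2 : ℚ) = D * b 0 := by simpa using hm 2
  have hb1 : (m 3 : ℚ) = D * b 1 := by simpa using hm 3
  have hd1 : (m 4 : ℚ) = D * d₁ := by simpa using hm 4
  have hd2 : (m 5 : ℚ) = D * d₂ := by simpa using hm 5
  have hm4 : m 4 ≠ 0 := by
    have : (m 4 : ℚ) ≠ 0 := by rw [hd1]; exact mul_ne_zero hD0 (left_ne_zero_of_mul hd)
    exact_mod_cast this
  have hm5 : m 5 ≠ 0 := by
    have : (m 5 : ℚ) ≠ 0 := by rw [hd2]; exact mul_ne_zero hD0 (right_ne_zero_of_mul hd)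
    exact_mod_cast this
  obtain ⟨C, hC⟩ : ∃ C : ℕ, |m 0| + |m 1| + |m 2| + |m 3| + |m 4| + |m 5| ≤ (C : ℤ) :=
    ⟨_, Int.self_le_toNat _⟩
  have hC1 : (1 : ℝ) ≤ C := by
    have := Int.one_le_abs hm4
    have : (1 : ℤ) ≤ C := by
      linarith [abs_nonneg (m 0), abs_nonneg (m 1), abs_nonneg (m 2), abs_nonneg (m 3),
        abs_nonneg (m 5)]
    exact_mod_cast this
  have hlogC := Real.log_nonneg hC1
  have hlog2 : 0 < Real.log 2 := Real.log_pos (by norm_num)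
  refine ⟨810 * (C : ℝ) ^ 2 * ((1 + Real.log C) / Real.log 2 + 1), by positivity,
    fun X hX => ?_⟩
  have hX0 : 0 ≤ X := by linarith
  have hn1 : 1 ≤ ⌊X⌋₊ := Nat.le_floor (by push_cast; linarith)
  have hn1' : (1 : ℝ) ≤ ⌊X⌋₊ := by exact_mod_cast hn1
  have hnX : (⌊X⌋₊ : ℝ) ≤ X := Nat.floor_le hX0
  have hcount := ncard_bilinear_le (m 0) (m 1) (m 2) (m 3) (m 4) (m 5) hm4 hm5 C ⌊X⌋₊ hC
    {p : (Fin 2 → ℤ) × ℤ × ℤ × ℤ × ℤ |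
          (∀ i, |(p.1 i : ℝ)| ≤ X) ∧ |(p.2.1 : ℝ)| ≤ X ∧ |(p.2.2.1 : ℝ)| ≤ X ∧
          |(p.2.2.2.1 : ℝ)| ≤ X ∧ |(p.2.2.2.2 : ℝ)| ≤ X ∧
          -(dotProduct
              (vecMul (fun i => (p.2.1 : ℚ) * ξ₁ i + (p.2.2.1 : ℚ) * ξ₂ i) (B⁻¹ * A₁))
              (fun i => (p.1 i : ℚ)))
            + d₁ * p.2.1 * p.2.2.2.1 + d₂ * p.2.2.1 * p.2.2.2.2 = 0} (by
      rintro ⟨x, z, w, z', w'⟩ ⟨hx, hz, hw, hz', hw', heq⟩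
      refine ⟨fun i => abs_le_floor_of_abs_le (hx i), abs_le_floor_of_abs_le hz,
        abs_le_floor_of_abs_le hw, abs_le_floor_of_abs_le hz',
        abs_le_floor_of_abs_le hw', ?_⟩
      have hlin : vecMul (fun i => (z : ℚ) * ξ₁ i + (w : ℚ) * ξ₂ i) (B⁻¹ * A₁) =
          (z : ℚ) • a + (w : ℚ) • b := by
        rw [ha, hb, ← smul_vecMul, ← smul_vecMul, ← add_vecMul]
        rfl
      simp only [hlin, dotProduct, Fin.sum_univ_two, Pi.add_apply, Pi.smul_apply,
        smul_eq_mul] at heq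
      have hq : (z : ℚ) * (m 4 * z' - (m 0 * x 0 + m 1 * x 1)) =
          w * (m 2 * x 0 + m 3 * x 1 - m 5 * w') := by
        rw [ha0, ha1, hb0, hb1, hd1, hd2]
        linear_combination (D : ℚ) * heq
      exact_mod_cast hq)
  have hbox := card_mulEqMulBox_le (N := C * ⌊X⌋₊)
    (Nat.mul_pos (by exact_mod_cast hC1) hn1)
  push_cast at hbox
  have hlogn : 0 ≤ Real.log ⌊X⌋₊ := Real.log_nonneg hn1'
  have hlognX : Real.log ⌊X⌋₊ ≤ Real.log X := Real.log_le_log (by linarith) hnX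
  have hlogX : Real.log 2 ≤ Real.log X := Real.log_le_log (by norm_num) hX
  rw [Real.log_mul (by linarith) (by linarith)] at hbox
  have hconst : 1 + Real.log C ≤ (1 + Real.log C) / Real.log 2 * Real.log X := by
    rw [div_mul_eq_mul_div, le_div_iff₀ hlog2]
    gcongr
  calc _ ≤ (2 * (⌊X⌋₊ : ℝ) + 1) ^ 2 * (mulEqMulBox (C * ⌊X⌋₊)).card := by exact_mod_cast hcount
    _ ≤ (3 * X) ^ 2 * (90 * (C * X) ^ 2 *
        ((1 + Real.log C) / Real.log 2 * Real.log X + Real.log X)) := by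
      gcongr
      · linarith
      · refine hbox.trans ?_
        gcongr ?_ * ?_
        · gcongr
        · linarith
    _ = _ := by ring
end

section
/- Let ξ_{b₁}, ξ_{b₂}, ξ_{b₃}, ξ_{b₄} ∈ ℚ² with rank(ξ_{b₁}, ξ_{b₂}) = 2, and let d_{b₁}, …, d_{b₄} ∈ ℚ with d_{b₃}·d_{b₄} ≠ 0. Then the number of integer tuples (y_{b₁}, …, y_{b₄}, y'_{b₁}, …, y'_{b₄}) ∈ [1,X]⁸ satisfying the system d_{b₁}y_{b₁}y'_{b₁} + d_{b₂}y_{b₂}y'_{b₂} + d_{b₃}y_{b₃}y'_{b₃} + d_{b₄}y_{b₄}y'_{b₄} = 0 and y_{b₁}ξ_{b₁} + y_{b₂}ξ_{b₂} + y_{b₃}ξ_{b₃} + y_{b₄}ξ_{b₄} = 0 is O(X⁴ log X). -/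
open Matrix

/-- A set of integers in `[1, N]` whose `D`-multiples are all congruent modulo `m ≤ N` has at most
`(D + 1) N / m` elements. -/
lemma card_mul_le_of_dvd_mul_sub {F : Finset ℤ} {N m D : ℕ} (hD : 0 < D) (hm : 0 < m)
    (hmN : m ≤ N) (hF : ∀ x ∈ F, 1 ≤ x ∧ x ≤ N)
    (hdvd : ∀ x ∈ F, ∀ y ∈ F, (m : ℤ) ∣ D * (x - y)) :
    F.card * m ≤ (D + 1) * N := by
  have hmZ : (0 : ℤ) < m := by exact_mod_cast hm
  have hDZ : (0 : ℤ) < D := by exact_mod_cast hD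
  have hcard : F.card ≤ (Finset.Icc (0 : ℤ) ((D * N : ℕ) / m : ℕ)).card := by
    refine Finset.card_le_card_of_injOn (fun x => D * x / m) ?_ ?_
    · intro x hx
      obtain ⟨h1, h2⟩ := hF x hx
      simp only [Finset.coe_Icc, Set.mem_Icc]
      push_cast
      exact ⟨by positivity, Int.ediv_le_ediv hmZ (by gcongr)⟩
    · intro x hx y hy hxy
      have hmod : (D : ℤ) * x % m = D * y % m :=
        (Int.modEq_iff_dvd.2 (mul_sub (D : ℤ) x y ▸ hdvd x hx y hy)).symm
      have hmul : (D : ℤ) * x = D * y := by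
        rw [← Int.mul_ediv_add_emod (D * x) m, ← Int.mul_ediv_add_emod (D * y) m, hmod]
        simp only at hxy
        rw [hxy]
      exact mul_left_cancel₀ hDZ.ne' hmul
  rw [Int.card_Icc] at hcard
  have hcard' : F.card ≤ D * N / m + 1 := by
    generalize D * N / m = k at hcard ⊢
    omega
  calc F.card * m ≤ (D * N / m + 1) * m := by gcongr
    _ = D * N / m * m + m := by ring
    _ ≤ D * N + N := add_le_add (Nat.div_mul_le_self _ _) hmN
    _ = (D + 1) * N := by ring

lemma card_mul_le_of_linear_eq {T : Finset (ℤ × ℤ)} {N u v : ℕ} {A B : ℤ} (hA : A ≠ 0)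
    (hB : B ≠ 0) (hv : 0 < v) (hvN : v ≤ N)
    (hT : ∀ p ∈ T, 1 ≤ p.1 ∧ p.1 ≤ N)
    (hlin : ∀ p ∈ T, ∀ q ∈ T, A * u * (p.1 - q.1) + B * v * (p.2 - q.2) = 0) :
    T.card * v ≤ (A.natAbs + 1) * N * u.gcd v := by
  have hg : 0 < u.gcd v := Nat.gcd_pos_of_pos_right _ hv
  obtain ⟨u', v', hcop, hu', hv'⟩ := Nat.exists_coprime u v
  have hv0 : 0 < v' := by
    rcases Nat.eq_zero_or_pos v' with h | h
    · rw [h] at hv'; omega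
    · exact h
  have hle : v' ≤ v := (Nat.le_mul_of_pos_right _ hg).trans_eq hv'.symm
  have hinj : Set.InjOn Prod.fst (T : Set (ℤ × ℤ)) := by
    intro p hp q hq hpq
    have h := hlin p hp q hq
    rw [hpq, sub_self, mul_zero, zero_add] at h
    have hBv : B * (v : ℤ) ≠ 0 := mul_ne_zero hB (by exact_mod_cast hv.ne')
    exact Prod.ext hpq (sub_eq_zero.1 ((mul_eq_zero.1 h).resolve_left hBv))
  have key : (T.image Prod.fst).card * v' ≤ (A.natAbs + 1) * N := by
    refine card_mul_le_of_dvd_mul_sub (Int.natAbs_pos.2 hA) hv0 (hle.trans hvN) ?_ ?_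
    · intro x hx
      obtain ⟨p, hp, rfl⟩ := Finset.mem_image.1 hx
      exact hT p hp
    · intro x hx y hy
      obtain ⟨p, hp, rfl⟩ := Finset.mem_image.1 hx
      obtain ⟨q, hq, rfl⟩ := Finset.mem_image.1 hy
      have h := hlin p hp q hq
      have hgZ : ((u.gcd v : ℕ) : ℤ) ≠ 0 := by exact_mod_cast hg.ne'
      have huZ : (u : ℤ) = u' * (u.gcd v : ℕ) := by exact_mod_cast hu'
      have hvZ : (v : ℤ) = v' * (u.gcd v : ℕ) := by exact_mod_cast hv'
      generalize ((u.gcd v : ℕ) : ℤ) = g at hgZ huZ hvZ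
      rw [huZ, hvZ] at h
      have h' : A * (p.1 - q.1) * u' = v' * (-(B * (p.2 - q.2))) := by
        apply mul_left_cancel₀ hgZ
        linear_combination h
      have hc : IsCoprime (v' : ℤ) (u' : ℤ) := (Nat.isCoprime_iff_coprime.2 hcop).symm
      have hdvd : (v' : ℤ) ∣ A * (p.1 - q.1) := hc.dvd_of_dvd_mul_right ⟨_, h'⟩
      rw [← Int.natAbs_dvd_natAbs, Int.natAbs_mul] at hdvd ⊢
      rwa [Int.natAbs_natCast]
  rw [Finset.card_image_of_injOn hinj] at key
  calc T.card * v = T.card * v' * u.gcd v := by rw [mul_assoc, ← hv']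
    _ ≤ (A.natAbs + 1) * N * u.gcd v := by gcongr

/-- The solutions of `A u s + B v t = e` in the box `[1, N]²` number at most
`O(N gcd(u, v) / max(u, v))`. -/
lemma card_mul_max_le_of_linear_eq {T : Finset (ℤ × ℤ)} {N u v : ℕ} {A B : ℤ} (hA : A ≠ 0)
    (hB : B ≠ 0) (hu : 0 < u) (huN : u ≤ N) (hv : 0 < v) (hvN : v ≤ N)
    (hT : ∀ p ∈ T, (1 ≤ p.1 ∧ p.1 ≤ N) ∧ 1 ≤ p.2 ∧ p.2 ≤ N)
    (hlin : ∀ p ∈ T, ∀ q ∈ T, A * u * (p.1 - q.1) + B * v * (p.2 - q.2) = 0) :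
    T.card * max u v ≤ (A.natAbs + B.natAbs + 1) * N * u.gcd v := by
  rcases le_total u v with h | h
  · rw [max_eq_right h]
    refine (card_mul_le_of_linear_eq hA hB hv hvN (fun p hp => (hT p hp).1) hlin).trans ?_
    gcongr
    omega
  · rw [max_eq_left h, ← Finset.card_image_of_injective T Prod.swap_injective, Nat.gcd_comm]
    refine (card_mul_le_of_linear_eq (T := T.image Prod.swap) (u := v) hB hA hu huN ?_ ?_).trans ?_
    · simp only [Finset.mem_image]
      rintro _ ⟨p, hp, rfl⟩
      exact (hT p hp).2
    · simp only [Finset.mem_image]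
      rintro _ ⟨p, hp, rfl⟩ _ ⟨q, hq, rfl⟩
      rw [add_comm]
      exact hlin p hp q hq
    · gcongr
      omega

lemma sum_gcd_div_le (N : ℕ) :
    ∑ v ∈ Finset.Ioc 0 N, ∑ u ∈ Finset.Ioc 0 v, (u.gcd v : ℝ) / v ≤ N * (1 + Real.log N) := by
  have hgcd : ∀ v ∈ Finset.Ioc 0 N, ∑ u ∈ Finset.Ioc 0 v, (u.gcd v : ℝ) / v ≤
      ∑ g ∈ Finset.Ioc 0 N, if g ∣ v then (1 : ℝ) else 0 := by
    intro v hv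
    rw [Finset.mem_Ioc] at hv
    have hvR : (0 : ℝ) < v := by exact_mod_cast hv.1
    calc ∑ u ∈ Finset.Ioc 0 v, (u.gcd v : ℝ) / v
        ≤ ∑ u ∈ Finset.Ioc 0 v, ∑ g ∈ Finset.Ioc 0 N,
            if g ∣ u then (if g ∣ v then (g : ℝ) / v else 0) else 0 := by
          refine Finset.sum_le_sum fun u hu => ?_
          have hmem : u.gcd v ∈ Finset.Ioc 0 N := Finset.mem_Ioc.2
            ⟨Nat.gcd_pos_of_pos_right _ hv.1, (Nat.gcd_le_right _ hv.1).trans hv.2⟩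
          refine le_trans (le_of_eq ?_) (Finset.single_le_sum (fun g _ => ?_) hmem)
          · simp [Nat.gcd_dvd_left, Nat.gcd_dvd_right]
          · split_ifs <;> positivity
      _ = ∑ g ∈ Finset.Ioc 0 N, if g ∣ v then (1 : ℝ) else 0 := by
          rw [Finset.sum_comm]
          refine Finset.sum_congr rfl fun g hg => ?_
          rw [← Finset.sum_filter, Finset.sum_const, Nat.Ioc_filter_dvd_card_eq_div]
          split_ifs with h
          · have hgR : (g : ℝ) ≠ 0 := by
              exact_mod_cast (Finset.mem_Ioc.1 hg).1.ne'
            rw [nsmul_eq_mul, Nat.cast_div h hgR]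
            field_simp
          · simp
  calc _ ≤ ∑ v ∈ Finset.Ioc 0 N, ∑ g ∈ Finset.Ioc 0 N, (if g ∣ v then (1 : ℝ) else 0) :=
        Finset.sum_le_sum hgcd
    _ = ∑ g ∈ Finset.Ioc 0 N, ((N / g : ℕ) : ℝ) := by
        rw [Finset.sum_comm]
        refine Finset.sum_congr rfl fun g _ => ?_
        rw [← Finset.sum_filter, Finset.sum_const, Nat.Ioc_filter_dvd_card_eq_div]
        simp
    _ ≤ ∑ g ∈ Finset.Ioc 0 N, (N : ℝ) * (g : ℝ)⁻¹ :=
        Finset.sum_le_sum fun g _ => Nat.cast_div_le.trans_eq (div_eq_mul_inv _ _)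
    _ = N * (harmonic N : ℝ) := by
        rw [← Finset.mul_sum, harmonic_eq_sum_Icc]
        push_cast
        rfl
    _ ≤ N * (1 + Real.log N) := by
        gcongr
        exact harmonic_le_one_add_log N

lemma sum_gcd_div_max_le (N : ℕ) :
    ∑ p ∈ Finset.Ioc 0 N ×ˢ Finset.Ioc 0 N, (p.1.gcd p.2 : ℝ) / (max p.1 p.2 : ℕ) ≤
      2 * N * (1 + Real.log N) := by
  have hhalf : ∑ p ∈ Finset.Ioc 0 N ×ˢ Finset.Ioc 0 N,
      (if p.1 ≤ p.2 then (p.1.gcd p.2 : ℝ) / p.2 else 0) ≤ N * (1 + Real.log N) := by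
    refine le_trans (le_of_eq ?_) (sum_gcd_div_le N)
    rw [Finset.sum_product_right]
    refine Finset.sum_congr rfl fun v hv => ?_
    rw [← Finset.sum_filter]
    refine Finset.sum_congr ?_ fun _ _ => rfl
    ext u
    simp only [Finset.mem_filter, Finset.mem_Ioc] at hv ⊢
    omega
  have hswap : ∑ p ∈ Finset.Ioc 0 N ×ˢ Finset.Ioc 0 N,
      (if p.2 ≤ p.1 then (p.2.gcd p.1 : ℝ) / p.1 else 0) ≤ N * (1 + Real.log N) := by
    rw [Finset.sum_product_right] at hhalf
    rwa [Finset.sum_product]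
  calc _ ≤ ∑ p ∈ Finset.Ioc 0 N ×ˢ Finset.Ioc 0 N,
        ((if p.1 ≤ p.2 then (p.1.gcd p.2 : ℝ) / p.2 else 0) +
          if p.2 ≤ p.1 then (p.2.gcd p.1 : ℝ) / p.1 else 0) := by
        refine Finset.sum_le_sum fun p _ => ?_
        rcases le_total p.1 p.2 with h | h
        · rw [max_eq_right h, if_pos h]
          exact le_add_of_nonneg_right (by split_ifs <;> positivity)
        · rw [max_eq_left h, if_pos h, Nat.gcd_comm]
          exact le_add_of_nonneg_left (by split_ifs <;> positivity)
    _ ≤ 2 * N * (1 + Real.log N) := by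
        rw [Finset.sum_add_distrib]
        linarith

lemma eq_of_sum_smul_eq_zero {ξ : Fin 4 → Fin 2 → ℚ} (hrank : (Matrix.of ![ξ 0, ξ 1]).rank = 2)
    {x y : Fin 4 → ℤ} (hx : ∑ i, (x i : ℚ) • ξ i = 0) (hy : ∑ i, (y i : ℚ) • ξ i = 0)
    (h2 : x 2 = y 2) (h3 : x 3 = y 3) : x = y := by
  have hli : LinearIndependent ℚ ![ξ 0, ξ 1] := by
    rw [linearIndependent_iff_card_eq_finrank_span]
    exact hrank.symm.trans (Matrix.rank_eq_finrank_span_row _)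
  rw [LinearIndependent.pair_iff] at hli
  have h := hli (x 0 - y 0) (x 1 - y 1) (by
    rw [Fin.sum_univ_four] at hx hy
    rw [h2, h3] at hx
    rw [sub_smul, sub_smul]
    linear_combination hx - hy)
  have h0 : x 0 = y 0 := by exact_mod_cast sub_eq_zero.1 h.1
  have h1 : x 1 = y 1 := by exact_mod_cast sub_eq_zero.1 h.2
  ext i
  fin_cases i <;> assumption

lemma exists_int_proportional {a b : ℚ} (ha : a ≠ 0) (hb : b ≠ 0) :
    ∃ (A B : ℤ) (k : ℚ), A ≠ 0 ∧ B ≠ 0 ∧ (A : ℚ) = k * a ∧ (B : ℚ) = k * b := by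
  refine ⟨a.num * b.den, b.num * a.den, a.den * b.den, ?_, ?_, ?_, ?_⟩
  · simp [ha]
  · simp [hb]
  · push_cast
    rw [← Rat.mul_den_eq_num a]
    ring
  · push_cast
    rw [← Rat.mul_den_eq_num b]
    ring

/-- Counting estimate from the proof of Lemma 4.6: with ξ₁,…,ξ₄ ∈ ℚ²,
rank(ξ₁,ξ₂) = 2 and d₃d₄ ≠ 0, the number of integer tuples
(y₁,…,y₄,y₁',…,y₄') ∈ [1,X]⁸ with Σᵢ dᵢ yᵢ yᵢ' = 0 and Σᵢ yᵢ ξᵢ = 0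
is O(X⁴ log X). -/
theorem stmt_17 (ξ : Fin 4 → Fin 2 → ℚ) (d : Fin 4 → ℚ)
    (hrank : (Matrix.of ![ξ 0, ξ 1]).rank = 2)
    (hd : d 2 * d 3 ≠ 0) :
    ∃ K : ℝ, 0 < K ∧ ∀ X : ℝ, 2 ≤ X →
      (({p : (Fin 4 → ℤ) × (Fin 4 → ℤ) |
          (∀ i, 1 ≤ p.1 i ∧ (p.1 i : ℝ) ≤ X) ∧ (∀ i, 1 ≤ p.2 i ∧ (p.2 i : ℝ) ≤ X) ∧
          (∑ i, d i * (p.1 i : ℚ) * (p.2 i : ℚ)) = 0 ∧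
          (∑ i, (p.1 i : ℚ) • ξ i) = 0}).ncard : ℝ)
      ≤ K * X ^ 4 * Real.log X := by
  obtain ⟨A, B, k, hA, hB, hAk, hBk⟩ :=
    exists_int_proportional (left_ne_zero_of_mul hd) (right_ne_zero_of_mul hd)
  set C : ℕ := A.natAbs + B.natAbs + 1
  refine ⟨6 * C, by positivity, fun X hX => ?_⟩
  set S : Set ((Fin 4 → ℤ) × (Fin 4 → ℤ)) := {p | _}
  set N : ℕ := ⌊X⌋₊ with hN
  have hX0 : 0 ≤ X := by linarith
  have hNX : (N : ℝ) ≤ X := Nat.floor_le hX0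
  have hle : ∀ z : ℤ, (z : ℝ) ≤ X → z ≤ N := fun z hz => by
    rw [hN, Int.natCast_floor_eq_floor hX0]
    exact Int.le_floor.2 hz
  have hSbox : ∀ p ∈ S, ∀ i, (1 ≤ p.1 i ∧ p.1 i ≤ N) ∧ (1 ≤ p.2 i ∧ p.2 i ≤ N) :=
    fun p hp i => ⟨⟨(hp.1 i).1, hle _ (hp.1 i).2⟩, (hp.2.1 i).1, hle _ (hp.2.1 i).2⟩
  have hfin : S.Finite := by
    have hbox : (Set.Icc (fun _ => 1) (fun _ => (N : ℤ)) : Set (Fin 4 → ℤ)).Finite :=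
      Set.finite_Icc _ _
    refine (hbox.prod hbox).subset fun p hp => ?_
    exact ⟨⟨fun i => (hSbox p hp i).1.1, fun i => (hSbox p hp i).1.2⟩,
      ⟨fun i => (hSbox p hp i).2.1, fun i => (hSbox p hp i).2.2⟩⟩
  let f : (Fin 4 → ℤ) × (Fin 4 → ℤ) → (ℕ × ℕ) × (ℕ × ℕ) := fun p =>
    (((p.2 0).toNat, (p.2 1).toNat), ((p.1 2).toNat, (p.1 3).toNat))
  let I : Finset (ℕ × ℕ) := Finset.Ioc 0 N ×ˢ Finset.Ioc 0 N
  have hmaps : Set.MapsTo f (hfin.toFinset : Set _) (I ×ˢ I : Finset _) := by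
    intro p hp
    have h := hSbox p (by simpa using hp)
    have := h 0
    have := h 1
    have := h 2
    have := h 3
    simp only [f, I, Finset.coe_product, Set.mem_prod, Finset.mem_coe, Finset.mem_Ioc]
    omega
  have hfiber : ∀ w ∈ I ×ˢ I, ((hfin.toFinset.filter (f · = w)).card : ℝ) ≤
      C * N * ((w.2.1.gcd w.2.2 : ℝ) / (max w.2.1 w.2.2 : ℕ)) := by
    rintro ⟨⟨a, b⟩, u, v⟩ hw
    simp only [I, Finset.mem_product, Finset.mem_Ioc] at hw
    set F := hfin.toFinset.filter (f · = ((a, b), u, v)) with hF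
    have hmem : ∀ p ∈ F, p ∈ S ∧ p.2 0 = a ∧ p.2 1 = b ∧ p.1 2 = u ∧ p.1 3 = v := by
      intro p hp
      simp only [hF, Finset.mem_filter, Set.Finite.mem_toFinset, f, Prod.mk.injEq] at hp
      have h := hSbox p hp.1
      have := h 0
      have := h 1
      have := h 2
      have := h 3
      exact ⟨hp.1, by omega⟩
    have hfst : ∀ p ∈ F, ∀ q ∈ F, p.1 = q.1 := by
      intro p hp q hq
      obtain ⟨hpS, -, -, hp2, hp3⟩ := hmem p hp
      obtain ⟨hqS, -, -, hq2, hq3⟩ := hmem q hq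
      exact eq_of_sum_smul_eq_zero hrank hpS.2.2.2 hqS.2.2.2 (hp2.trans hq2.symm)
        (hp3.trans hq3.symm)
    let π : (Fin 4 → ℤ) × (Fin 4 → ℤ) → ℤ × ℤ := fun p => (p.2 2, p.2 3)
    have hinj : Set.InjOn π (F : Set _) := by
      intro p hp q hq hpq
      obtain ⟨-, hp0, hp1, -⟩ := hmem p hp
      obtain ⟨-, hq0, hq1, -⟩ := hmem q hq
      simp only [π, Prod.mk.injEq] at hpq
      refine Prod.ext (hfst p hp q hq) (funext fun i => ?_)
      fin_cases i
      exacts [hp0.trans hq0.symm, hp1.trans hq1.symm, hpq.1, hpq.2]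
    have hcard : (F.image π).card * max u v ≤ C * N * u.gcd v := by
      refine card_mul_max_le_of_linear_eq hA hB hw.2.1.1 hw.2.1.2 hw.2.2.1 hw.2.2.2 ?_ ?_
      · intro s hs
        obtain ⟨p, hp, rfl⟩ := Finset.mem_image.1 hs
        have h := hSbox p (hmem p hp).1
        exact ⟨(h 2).2, (h 3).2⟩
      · intro s hs t ht
        obtain ⟨p, hp, rfl⟩ := Finset.mem_image.1 hs
        obtain ⟨q, hq, rfl⟩ := Finset.mem_image.1 ht
        obtain ⟨hpS, hp0, hp1, hp2, hp3⟩ := hmem p hp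
        obtain ⟨hqS, hq0, hq1, hq2, hq3⟩ := hmem q hq
        have hpe := hpS.2.2.1
        have hqe := hqS.2.2.1
        rw [Fin.sum_univ_four, hp0, hp1, hp2, hp3, hfst p hp q hq] at hpe
        rw [Fin.sum_univ_four, hq0, hq1, hq2, hq3] at hqe
        have hQ : (A : ℚ) * u * (p.2 2 - q.2 2) + B * v * (p.2 3 - q.2 3) = 0 := by
          rw [hAk, hBk]
          push_cast at hpe hqe
          linear_combination k * hpe - k * hqe
        exact_mod_cast hQ
    rw [Finset.card_image_of_injOn hinj] at hcard
    have hmax : (0 : ℝ) < (max u v : ℕ) := by exact_mod_cast lt_max_of_lt_left hw.2.1.1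
    rw [← mul_div_assoc, le_div_iff₀ hmax]
    exact_mod_cast hcard
  have hlog2 : 1 / 2 ≤ Real.log X :=
    le_trans (by linarith [Real.log_two_gt_d9]) (Real.log_le_log (by norm_num) hX)
  have hN0 : 0 < N := Nat.floor_pos.2 (by linarith)
  have hlogN : Real.log N ≤ Real.log X := Real.log_le_log (by exact_mod_cast hN0) hNX
  rw [Set.ncard_eq_toFinset_card S hfin, Finset.card_eq_sum_card_fiberwise hmaps]
  push_cast
  calc _ ≤ ∑ w ∈ I ×ˢ I, C * N * ((w.2.1.gcd w.2.2 : ℝ) / (max w.2.1 w.2.2 : ℕ)) :=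
        Finset.sum_le_sum hfiber
    _ = N ^ 2 * (C * N * ∑ p ∈ I, (p.1.gcd p.2 : ℝ) / (max p.1 p.2 : ℕ)) := by
        rw [← Finset.mul_sum, Finset.sum_product]
        simp only [Finset.sum_const, nsmul_eq_mul, I, Finset.card_product, Nat.card_Ioc, Nat.sub_zero]
        push_cast
        ring
    _ ≤ X ^ 2 * (C * X * (2 * X * (3 * Real.log X))) := by
        gcongr
        refine (sum_gcd_div_max_le N).trans ?_
        gcongr
        linarith
    _ = 6 * C * X ^ 4 * Real.log X := by ring
end
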